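/- No-go theorem for the odd polynomials: every admissible quantization of (Õ, P¹) is trivial, i.e., any such quantization Q satisfies Q(S₁) = Q(S₂) = Q(S₃) = 0. -/

import Mathlib

open MvPolynomial MeasureTheory

noncomputable section

attribute [local instance] Classical.propDecidable

/-- The Poisson bracket on `ℝ[X₀,X₁,X₂]` associated to the sphere:
`{f,g} = Σ εᵢⱼₖ Xᵢ ∂f/∂Xⱼ ∂g/∂Xₖ` (indices `0,1,2` play the role of `1,2,3`). -/
def pb (f g : MvPolynomial (Fin 3) ℝ) : MvPolynomial (Fin 3) ℝ :=
  X 0 * (pderiv 1 f * pderiv 2 g - pderiv 2 f * pderiv 1 g) +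
  X 1 * (pderiv 2 f * pderiv 0 g - pderiv 0 f * pderiv 2 g) +
  X 2 * (pderiv 0 f * pderiv 1 g - pderiv 1 f * pderiv 0 g)

/-- The ideal generated by `X₀² + X₁² + X₂² - s²`. -/
def sphereIdeal (s : ℝ) : Ideal (MvPolynomial (Fin 3) ℝ) :=
  Ideal.span {X 0 ^ 2 + X 1 ^ 2 + X 2 ^ 2 - C (s ^ 2)}

/-- The Poisson algebra `P` of polynomial functions on the sphere of radius `s`. -/
abbrev SpherePoly (s : ℝ) := MvPolynomial (Fin 3) ℝ ⧸ sphereIdeal s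

/-- The quotient map `ℝ[X₀,X₁,X₂] → P`. -/
def toSphere (s : ℝ) : MvPolynomial (Fin 3) ℝ →+* SpherePoly s :=
  Ideal.Quotient.mk (sphereIdeal s)

/-- The components `S₁, S₂, S₃` of the spin vector (indexed by `Fin 3`). -/
def S (s : ℝ) (i : Fin 3) : SpherePoly s := toSphere s (X i)

/-- A choice of polynomial representative of an element of `P`. -/
def rep (s : ℝ) (p : SpherePoly s) : MvPolynomial (Fin 3) ℝ :=
  (Ideal.Quotient.mk_surjective (I := sphereIdeal s) p).choose

/-- The Poisson bracket descended to `P`.  (It is independent of the choice of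
representatives, since the bracket of any polynomial with the generator
`X₀² + X₁² + X₂² - s²` vanishes identically.) -/
def pbS (s : ℝ) (p q : SpherePoly s) : SpherePoly s :=
  toSphere s (pb (rep s p) (rep s q))

/-- The Laplacian on `ℝ[X₀,X₁,X₂]` as a linear map. -/
def laplacian : MvPolynomial (Fin 3) ℝ →ₗ[ℝ] MvPolynomial (Fin 3) ℝ :=
  (pderiv 0).toLinearMap ∘ₗ (pderiv 0).toLinearMap +
  (pderiv 1).toLinearMap ∘ₗ (pderiv 1).toLinearMap +
  (pderiv 2).toLinearMap ∘ₗ (pderiv 2).toLinearMap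

/-- Homogeneous harmonic polynomials of degree `l`. -/
def harmonicHomog (l : ℕ) : Submodule ℝ (MvPolynomial (Fin 3) ℝ) :=
  homogeneousSubmodule (Fin 3) ℝ l ⊓ LinearMap.ker laplacian

/-- `H_l`, the image in `P` of the homogeneous harmonic polynomials of degree `l`. -/
def Hsph (s : ℝ) (l : ℕ) : Submodule ℝ (SpherePoly s) :=
  (harmonicHomog l).map (Ideal.Quotient.mkₐ ℝ (sphereIdeal s)).toLinearMap

/-- `O`, the odd polynomials: the sum of the `H_l` over odd `l`. -/
def Osph (s : ℝ) : Submodule ℝ (SpherePoly s) :=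
  ⨆ (l : ℕ) (_ : Odd l), Hsph s l

/-- `Õ = ℝ·1 ⊕ O`. -/
def Otilde (s : ℝ) : Submodule ℝ (SpherePoly s) :=
  Submodule.span ℝ ({1} : Set (SpherePoly s)) ⊔ Osph s

theorem S_mem_H1 (s : ℝ) (i : Fin 3) : S s i ∈ Hsph s 1 := by
  refine ⟨X i, ⟨isHomogeneous_X _ _, ?_⟩, rfl⟩
  fin_cases i <;> simp [laplacian, pderiv_X]

theorem S_mem_Otilde (s : ℝ) (i : Fin 3) : S s i ∈ Otilde s :=
  Submodule.mem_sup_right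
    ((le_iSup₂ (f := fun (l : ℕ) (_ : Odd l) => Hsph s l) 1 odd_one) (S_mem_H1 s i))

theorem one_mem_Otilde (s : ℝ) : (1 : SpherePoly s) ∈ Otilde s :=
  Submodule.mem_sup_left (Submodule.mem_span_singleton_self 1)

theorem pderiv_pderiv_comm (i j : Fin 3) (p : MvPolynomial (Fin 3) ℝ) :
    pderiv i (pderiv j p) = pderiv j (pderiv i p) := by
  have h : ⁅(pderiv i : Derivation ℝ _ (MvPolynomial (Fin 3) ℝ)),
      (pderiv j : Derivation ℝ _ (MvPolynomial (Fin 3) ℝ))⁆ = 0 := by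
    refine MvPolynomial.derivation_ext fun k => ?_
    rw [Derivation.commutator_apply]
    simp [pderiv_X, Pi.single_apply, apply_ite]
  have hp := DFunLike.congr_fun h p
  rwa [Derivation.commutator_apply, Derivation.zero_apply, sub_eq_zero] at hp

theorem pb_mul_left (f g h : MvPolynomial (Fin 3) ℝ) : pb (f * g) h = f * pb g h + g * pb f h := by
  simp only [pb, Derivation.leibniz, smul_eq_mul]; ring

theorem pb_swap (f g : MvPolynomial (Fin 3) ℝ) : pb f g = -pb g f := by
  simp only [pb]; ring

theorem pb_sphere (s : ℝ) (g : MvPolynomial (Fin 3) ℝ) :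
    pb (X 0 ^ 2 + X 1 ^ 2 + X 2 ^ 2 - C (s ^ 2)) g = 0 := by
  simp [pb, pderiv_X, Derivation.leibniz_pow]; ring

theorem pb_sub_left (f g h : MvPolynomial (Fin 3) ℝ) : pb (f - g) h = pb f h - pb g h := by
  simp only [pb, map_sub]; ring

theorem toSphere_pb_congr_left (s : ℝ) {f f' : MvPolynomial (Fin 3) ℝ}
    (g : MvPolynomial (Fin 3) ℝ) (h : toSphere s f = toSphere s f') :
    toSphere s (pb f g) = toSphere s (pb f' g) := by
  rw [toSphere, Ideal.Quotient.eq, sphereIdeal, Ideal.mem_span_singleton'] at h ⊢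
  obtain ⟨c, hc⟩ := h
  exact ⟨pb c g, by rw [← pb_sub_left, ← hc, pb_mul_left, pb_sphere]; ring⟩

theorem pbS_toSphere (s : ℝ) (f g : MvPolynomial (Fin 3) ℝ) :
    pbS s (toSphere s f) (toSphere s g) = toSphere s (pb f g) := by
  have hrep (p : MvPolynomial (Fin 3) ℝ) : toSphere s (rep s (toSphere s p)) = toSphere s p :=
    (Ideal.Quotient.mk_surjective (I := sphereIdeal s) (toSphere s p)).choose_spec
  rw [pbS, toSphere_pb_congr_left s _ (hrep f), pb_swap, map_neg,
    toSphere_pb_congr_left s _ (hrep g), ← map_neg, ← pb_swap]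

theorem toSphere_sum_sq_mul (s : ℝ) (p : MvPolynomial (Fin 3) ℝ) :
    toSphere s ((X 0 ^ 2 + X 1 ^ 2 + X 2 ^ 2) * p) = s ^ 2 • toSphere s p := by
  have h : toSphere s (X 0 ^ 2 + X 1 ^ 2 + X 2 ^ 2) = toSphere s (C (s ^ 2)) := by
    rw [toSphere, Ideal.Quotient.eq]
    exact Ideal.mem_span_singleton_self _
  rw [map_mul, h, ← map_mul, ← smul_eq_C_mul]
  rfl

/-- The polynomials whose image in `P` lies in `Õ`. -/
def oddLift (s : ℝ) : Submodule ℝ (MvPolynomial (Fin 3) ℝ) :=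
  (Otilde s).comap (Ideal.Quotient.mkₐ ℝ (sphereIdeal s)).toLinearMap

theorem mem_oddLift {s : ℝ} {p : MvPolynomial (Fin 3) ℝ} :
    p ∈ oddLift s ↔ toSphere s p ∈ Otilde s := Iff.rfl

theorem harmonicHomog_le_oddLift (s : ℝ) {l : ℕ} (hl : Odd l) : harmonicHomog l ≤ oddLift s := by
  intro p hp
  exact Submodule.mem_sup_right
    ((le_iSup₂ (f := fun (l : ℕ) (_ : Odd l) => Hsph s l) l hl) ⟨p, hp, rfl⟩)

theorem sum_sq_mul_mem_oddLift {s : ℝ} {p : MvPolynomial (Fin 3) ℝ} (hp : p ∈ oddLift s) :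
    (X 0 ^ 2 + X 1 ^ 2 + X 2 ^ 2) * p ∈ oddLift s := by
  rw [mem_oddLift, toSphere_sum_sq_mul]
  exact Submodule.smul_mem _ _ hp

/-- Bracketing with a coordinate, as a linear map. -/
def pbX (i : Fin 3) : MvPolynomial (Fin 3) ℝ →ₗ[ℝ] MvPolynomial (Fin 3) ℝ where
  toFun := pb (X i)
  map_add' f g := by simp only [pb, map_add]; ring
  map_smul' c f := by simp only [pb, smul_eq_C_mul, pderiv_C_mul, RingHom.id_apply]; ring

theorem pbX_mem_harmonicHomog (i : Fin 3) {l : ℕ} (hl : l ≠ 0) {p : MvPolynomial (Fin 3) ℝ}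
    (hp : p ∈ harmonicHomog l) : pbX i p ∈ harmonicHomog l := by
  obtain ⟨hhom, hlap⟩ := hp
  have hX (j k : Fin 3) : X j * pderiv k p ∈ homogeneousSubmodule (Fin 3) ℝ l := by
    have := (isHomogeneous_X ℝ j).mul
      (IsHomogeneous.pderiv (i := k) ((mem_homogeneousSubmodule l p).1 hhom))
    rwa [show 1 + (l - 1) = l by lia] at this
  refine ⟨?_, ?_⟩
  · fin_cases i
    · have : pbX 0 p = X 2 * pderiv 1 p - X 1 * pderiv 2 p := by
        simp [pbX, pb, pderiv_X]; ring
      exact this ▸ sub_mem (hX _ _) (hX _ _)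
    · have : pbX 1 p = X 0 * pderiv 2 p - X 2 * pderiv 0 p := by
        simp [pbX, pb, pderiv_X]; ring
      exact this ▸ sub_mem (hX _ _) (hX _ _)
    · have : pbX 2 p = X 1 * pderiv 0 p - X 0 * pderiv 1 p := by
        simp [pbX, pb, pderiv_X]; ring
      exact this ▸ sub_mem (hX _ _) (hX _ _)
  · have hcomm : laplacian (pbX i p) = pbX i (laplacian p) := by
      have c10 (q : MvPolynomial (Fin 3) ℝ) : pderiv 1 (pderiv 0 q) = pderiv 0 (pderiv 1 q) :=
        pderiv_pderiv_comm _ _ _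
      have c20 (q : MvPolynomial (Fin 3) ℝ) : pderiv 2 (pderiv 0 q) = pderiv 0 (pderiv 2 q) :=
        pderiv_pderiv_comm _ _ _
      have c21 (q : MvPolynomial (Fin 3) ℝ) : pderiv 2 (pderiv 1 q) = pderiv 1 (pderiv 2 q) :=
        pderiv_pderiv_comm _ _ _
      fin_cases i <;> simp [laplacian, pbX, pb, pderiv_X, c10, c20, c21] <;> ring
    rw [SetLike.mem_coe, LinearMap.mem_ker, hcomm, LinearMap.mem_ker.1 hlap, map_zero]

theorem pbX_mem_oddLift (s : ℝ) (i : Fin 3) {p : MvPolynomial (Fin 3) ℝ} (hp : p ∈ oddLift s) :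
    pbX i p ∈ oddLift s := by
  set M : Submodule ℝ (MvPolynomial (Fin 3) ℝ) :=
    Submodule.span ℝ {1} ⊔ ⨆ (l : ℕ) (_ : Odd l), harmonicHomog l with hM
  have hmap : Otilde s = M.map (Ideal.Quotient.mkₐ ℝ (sphereIdeal s)).toLinearMap := by
    simp [Otilde, Osph, Hsph, hM, Submodule.map_sup, Submodule.map_iSup, Submodule.map_span]
  have hstable : M ≤ M.comap (pbX i) := by
    refine sup_le ?_ (iSup₂_le fun l hl q hq => ?_)
    · rw [Submodule.span_singleton_le_iff_mem, Submodule.mem_comap]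
      simp [pbX, pb]
    · exact Submodule.mem_sup_right
        ((le_iSup₂ (f := fun (l : ℕ) (_ : Odd l) => harmonicHomog l) l hl)
          (pbX_mem_harmonicHomog i hl.pos.ne' hq))
  rw [mem_oddLift, hmap] at hp
  obtain ⟨q, hq, hqp⟩ := hp
  have h : toSphere s (pb q (X i)) = toSphere s (pb p (X i)) := toSphere_pb_congr_left s _ hqp
  rw [mem_oddLift, hmap]
  refine ⟨pbX i q, hstable hq, ?_⟩
  change toSphere s (pb (X i) q) = toSphere s (pb (X i) p)
  rw [pb_swap, map_neg, h, ← map_neg, ← pb_swap]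

theorem pderiv_two (i : Fin 3) : pderiv i (2 : MvPolynomial (Fin 3) ℝ) = 0 :=
  Derivation.map_natCast _ 2

/-- The odd zonal polynomial `z (x² + y²)ᵐ`. -/
def zonal (m : ℕ) : MvPolynomial (Fin 3) ℝ := X 2 * (X 0 ^ 2 + X 1 ^ 2) ^ m

theorem laplacian_zonal (j : ℕ) :
    laplacian (zonal (j + 1)) = (4 * (j + 1) ^ 2 : ℝ) • zonal j := by
  rcases j with _ | j <;>
  simp [laplacian, zonal, pderiv_X, Derivation.leibniz_pow, smul_eq_C_mul, map_ofNat,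
    pderiv_two] <;> ring

theorem laplacian_zonal_zero_mul (k : ℕ) :
    laplacian (zonal 0 * (X 0 ^ 2 + X 1 ^ 2 + X 2 ^ 2) ^ (k + 1)) =
      (2 * (k + 1) * (2 * k + 5) : ℝ) • (zonal 0 * (X 0 ^ 2 + X 1 ^ 2 + X 2 ^ 2) ^ k) := by
  rcases k with _ | k <;>
  simp [laplacian, zonal, pderiv_X, Derivation.leibniz_pow, smul_eq_C_mul, map_ofNat,
    pderiv_two] <;> ring

theorem laplacian_zonal_succ_mul (j k : ℕ) :
    laplacian (zonal (j + 1) * (X 0 ^ 2 + X 1 ^ 2 + X 2 ^ 2) ^ (k + 1)) =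
      (4 * (j + 1) ^ 2 : ℝ) • (zonal j * (X 0 ^ 2 + X 1 ^ 2 + X 2 ^ 2) ^ (k + 1)) +
      (2 * (k + 1) * (2 * k + 4 * j + 9) : ℝ) •
        (zonal (j + 1) * (X 0 ^ 2 + X 1 ^ 2 + X 2 ^ 2) ^ k) := by
  rcases j with _ | j <;> rcases k with _ | k <;>
  simp [laplacian, zonal, pderiv_X, Derivation.leibniz_pow, smul_eq_C_mul, map_ofNat,
    pderiv_two] <;> ring

theorem casimir_zonal_succ (m : ℕ) :
    pbX 0 (pbX 0 (zonal (m + 1))) + pbX 1 (pbX 1 (zonal (m + 1))) +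
      pbX 2 (pbX 2 (zonal (m + 1))) =
    (-(2 * (2 * m + 3) * (m + 2)) : ℝ) • zonal (m + 1) +
      (4 * (m + 1) ^ 2 : ℝ) • ((X 0 ^ 2 + X 1 ^ 2 + X 2 ^ 2) * zonal m) := by
  rcases m with _ | m <;>
  simp [pbX, pb, zonal, pderiv_X, Derivation.leibniz_pow, smul_eq_C_mul, map_ofNat,
    pderiv_two] <;> ring

theorem isHomogeneous_X_sq (i : Fin 3) : (X i ^ 2 : MvPolynomial (Fin 3) ℝ).IsHomogeneous 2 :=
  isHomogeneous_X_pow _ _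

theorem isHomogeneous_sum_sq :
    (X 0 ^ 2 + X 1 ^ 2 + X 2 ^ 2 : MvPolynomial (Fin 3) ℝ).IsHomogeneous 2 :=
  ((isHomogeneous_X_sq 0).add (isHomogeneous_X_sq 1)).add (isHomogeneous_X_sq 2)

theorem isHomogeneous_zonal (m : ℕ) : (zonal m).IsHomogeneous (2 * m + 1) := by
  have := (isHomogeneous_X ℝ (2 : Fin 3)).mul
    (((isHomogeneous_X_sq 0).add (isHomogeneous_X_sq 1)).pow m)
  rwa [add_comm 1] at this

theorem isHomogeneous_zonal_mul (j k : ℕ) :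
    (zonal j * (X 0 ^ 2 + X 1 ^ 2 + X 2 ^ 2) ^ k).IsHomogeneous (2 * (j + k) + 1) := by
  convert (isHomogeneous_zonal j).mul (isHomogeneous_sum_sq.pow k) using 1
  ring

theorem exists_laplacian_sum_sq_mul_eq (j k : ℕ) :
    ∃ q : MvPolynomial (Fin 3) ℝ, q.IsHomogeneous (2 * (j + k) + 1) ∧
      q ∈ Submodule.span ℝ {p : MvPolynomial (Fin 3) ℝ | ∃ i ≤ j, ∃ n,
        p = zonal i * (X 0 ^ 2 + X 1 ^ 2 + X 2 ^ 2) ^ n} ∧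
      laplacian ((X 0 ^ 2 + X 1 ^ 2 + X 2 ^ 2) * q) =
        zonal j * (X 0 ^ 2 + X 1 ^ 2 + X 2 ^ 2) ^ k := by
  induction j generalizing k with
  | zero =>
    have hc : (2 * (k + 1) * (2 * k + 5) : ℝ) ≠ 0 := by positivity
    refine ⟨(2 * (k + 1) * (2 * k + 5) : ℝ)⁻¹ •
      (zonal 0 * (X 0 ^ 2 + X 1 ^ 2 + X 2 ^ 2) ^ k),
      (homogeneousSubmodule (Fin 3) ℝ _).smul_mem _ (isHomogeneous_zonal_mul 0 k),
      Submodule.smul_mem _ _ (Submodule.subset_span ⟨0, le_rfl, k, rfl⟩), ?_⟩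
    rw [mul_smul_comm, map_smul, mul_left_comm, ← pow_succ', laplacian_zonal_zero_mul,
      inv_smul_smul₀ hc]
  | succ j ih =>
    obtain ⟨q, hq, hspan, hlap⟩ := ih (k + 1)
    have hc : (2 * (k + 1) * (2 * k + 4 * j + 9) : ℝ) ≠ 0 := by positivity
    rw [show 2 * (j + (k + 1)) + 1 = 2 * (j + 1 + k) + 1 by ring] at hq
    refine ⟨(2 * (k + 1) * (2 * k + 4 * j + 9) : ℝ)⁻¹ •
      (zonal (j + 1) * (X 0 ^ 2 + X 1 ^ 2 + X 2 ^ 2) ^ k - (4 * (j + 1) ^ 2 : ℝ) • q),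
      (homogeneousSubmodule (Fin 3) ℝ _).smul_mem _
        (sub_mem (isHomogeneous_zonal_mul (j + 1) k) (Submodule.smul_mem _ _ hq)),
      Submodule.smul_mem _ _ (sub_mem (Submodule.subset_span ⟨j + 1, le_rfl, k, rfl⟩)
        (Submodule.smul_mem _ _ (Submodule.span_mono ?_ hspan))), ?_⟩
    · rintro p ⟨i, hi, n, rfl⟩
      exact ⟨i, by lia, n, rfl⟩
    · rw [mul_smul_comm, map_smul, mul_sub, mul_smul_comm, map_sub, map_smul, hlap,
        mul_left_comm, ← pow_succ', laplacian_zonal_succ_mul, add_sub_cancel_left,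
        inv_smul_smul₀ hc]

theorem zonal_mem_oddLift (s : ℝ) (m : ℕ) : zonal m ∈ oddLift s := by
  induction m using Nat.strong_induction_on with
  | _ m ih =>
    rcases m with _ | m
    · simpa [zonal] using mem_oddLift.2 (S_mem_Otilde s 2)
    obtain ⟨q, hq, hspan, hlap⟩ := exists_laplacian_sum_sq_mul_eq m 0
    have hqs : q ∈ oddLift s := by
      refine Submodule.span_le.2 ?_ hspan
      rintro p ⟨i, hi, n, rfl⟩
      induction n with
      | zero => simpa using ih i (by lia)
      | succ n ihn =>
        rw [pow_succ', mul_left_comm]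
        exact sum_sq_mul_mem_oddLift ihn
    have hharm : zonal (m + 1) - (4 * (m + 1) ^ 2 : ℝ) • ((X 0 ^ 2 + X 1 ^ 2 + X 2 ^ 2) * q) ∈
        harmonicHomog (2 * (m + 1) + 1) := by
      refine ⟨sub_mem (isHomogeneous_zonal _) (Submodule.smul_mem _ _ ?_), ?_⟩
      · have := isHomogeneous_sum_sq.mul hq
        rwa [show 2 + (2 * (m + 0) + 1) = 2 * (m + 1) + 1 by ring] at this
      · rw [SetLike.mem_coe, LinearMap.mem_ker, map_sub, map_smul, hlap, laplacian_zonal,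
          pow_zero, mul_one, sub_self]
    have := add_mem (harmonicHomog_le_oddLift s (odd_two_mul_add_one _) hharm)
      (Submodule.smul_mem _ (4 * (m + 1) ^ 2 : ℝ) (sum_sq_mul_mem_oddLift hqs))
    rwa [sub_add_cancel] at this

/-- The real and imaginary parts of `(x + iy)ⁿ`. -/
def reImPow : ℕ → MvPolynomial (Fin 3) ℝ × MvPolynomial (Fin 3) ℝ
  | 0 => (1, 0)
  | n + 1 => (X 0 * (reImPow n).1 - X 1 * (reImPow n).2, X 0 * (reImPow n).2 + X 1 * (reImPow n).1)

theorem isHomogeneous_reImPow (n : ℕ) :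
    (reImPow n).1.IsHomogeneous n ∧ (reImPow n).2.IsHomogeneous n := by
  induction n with
  | zero => exact ⟨isHomogeneous_one _ _, isHomogeneous_zero _ _ _⟩
  | succ n ih =>
    have hX (i : Fin 3) {p : MvPolynomial (Fin 3) ℝ} (hp : p.IsHomogeneous n) :
        (X i * p).IsHomogeneous (n + 1) := add_comm 1 n ▸ (isHomogeneous_X ℝ i).mul hp
    exact ⟨(hX 0 ih.1).sub (hX 1 ih.2), (hX 0 ih.2).add (hX 1 ih.1)⟩

theorem pderiv_reImPow_succ (n : ℕ) :
    pderiv 0 (reImPow (n + 1)).1 = (n + 1) * (reImPow n).1 ∧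
    pderiv 1 (reImPow (n + 1)).1 = -((n + 1) * (reImPow n).2) ∧
    pderiv 0 (reImPow (n + 1)).2 = (n + 1) * (reImPow n).2 ∧
    pderiv 1 (reImPow (n + 1)).2 = (n + 1) * (reImPow n).1 := by
  induction n with
  | zero => simp [reImPow, pderiv_X]
  | succ n ih =>
    obtain ⟨h1, h2, h3, h4⟩ := ih
    rw [reImPow]
    simp only [map_sub, map_add, Derivation.leibniz, smul_eq_mul, h1, h2, h3, h4, pderiv_X_self,
      pderiv_X_of_ne (show (0 : Fin 3) ≠ 1 by decide),
      pderiv_X_of_ne (show (1 : Fin 3) ≠ 0 by decide)]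
    simp only [reImPow]
    push_cast
    refine ⟨?_, ?_, ?_, ?_⟩ <;> ring

theorem pderiv_two_reImPow (n : ℕ) :
    pderiv 2 (reImPow n).1 = 0 ∧ pderiv 2 (reImPow n).2 = 0 := by
  induction n with
  | zero => simp [reImPow]
  | succ n ih => simp [reImPow, ih.1, ih.2, pderiv_X]

theorem sum_sq_reImPow (n : ℕ) :
    (reImPow n).1 ^ 2 + (reImPow n).2 ^ 2 = (X 0 ^ 2 + X 1 ^ 2) ^ n := by
  induction n with
  | zero => simp [reImPow]
  | succ n ih => rw [pow_succ _ n, ← ih, reImPow]; ring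

theorem reImPow_mem_harmonicHomog (n : ℕ) :
    (reImPow n).1 ∈ harmonicHomog n ∧ (reImPow n).2 ∈ harmonicHomog n := by
  suffices h : laplacian (reImPow n).1 = 0 ∧ laplacian (reImPow n).2 = 0 from
    ⟨⟨(isHomogeneous_reImPow n).1, h.1⟩, ⟨(isHomogeneous_reImPow n).2, h.2⟩⟩
  have hcast (i : Fin 3) (k : ℕ) : pderiv i (k : MvPolynomial (Fin 3) ℝ) = 0 :=
    Derivation.map_natCast _ k
  rcases n with _ | _ | n
  · simp [laplacian, reImPow]
  · simp [laplacian, reImPow, pderiv_X]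
  · obtain ⟨h1, h2, h3, h4⟩ := pderiv_reImPow_succ n
    obtain ⟨k1, k2, k3, k4⟩ := pderiv_reImPow_succ (n + 1)
    obtain ⟨l1, l2⟩ := pderiv_two_reImPow (n + 1 + 1)
    constructor <;>
    simp [laplacian, h1, h2, h3, h4, k1, k2, k3, k4, l1, l2, hcast]

theorem pb_X_two_reImPow (n : ℕ) :
    pb (X 2) (reImPow (n + 1)).1 = (n + 1 : ℝ) • (reImPow (n + 1)).2 ∧
    pb (X 2) (reImPow (n + 1)).2 = (-(n + 1) : ℝ) • (reImPow (n + 1)).1 := by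
  obtain ⟨h1, h2, h3, h4⟩ := pderiv_reImPow_succ n
  constructor <;>
  simp [pb, h1, h2, h3, h4, pderiv_X, smul_eq_C_mul, -map_add] <;> simp [reImPow] <;> ring

theorem pb_reImPow_succ (n : ℕ) :
    pb (reImPow (n + 1)).1 (reImPow (n + 1)).2 = ((n + 1) ^ 2 : ℝ) • zonal n := by
  obtain ⟨h1, h2, h3, h4⟩ := pderiv_reImPow_succ n
  obtain ⟨l1, l2⟩ := pderiv_two_reImPow (n + 1)
  simp only [pb, h1, h2, h3, h4, l1, l2, zonal, ← sum_sq_reImPow, smul_eq_C_mul, map_add, map_pow,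
    map_natCast, map_one]
  ring

/-- The polynomials in `oddLift s` annihilated by `Q`. -/
def oddKer {s : ℝ} {E : Type*} [AddCommGroup E] [Module ℝ E] (Q : Otilde s →ₗ[ℝ] E) :
    Submodule ℝ (MvPolynomial (Fin 3) ℝ) :=
  ((LinearMap.ker Q).map (Otilde s).subtype).comap
    (Ideal.Quotient.mkₐ ℝ (sphereIdeal s)).toLinearMap

theorem mem_oddKer {s : ℝ} {E : Type*} [AddCommGroup E] [Module ℝ E] {Q : Otilde s →ₗ[ℝ] E}
    {p : MvPolynomial (Fin 3) ℝ} (hp : p ∈ oddLift s) :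
    p ∈ oddKer Q ↔ Q ⟨toSphere s p, hp⟩ = 0 := by
  constructor
  · rintro ⟨⟨x, hx⟩, hQ, rfl : x = _⟩
    exact hQ
  · exact fun h => ⟨⟨_, hp⟩, h, rfl⟩

theorem oddKer_le_oddLift {s : ℝ} {E : Type*} [AddCommGroup E] [Module ℝ E]
    (Q : Otilde s →ₗ[ℝ] E) : oddKer Q ≤ oddLift s := by
  rintro p ⟨⟨x, hx⟩, -, rfl : x = _⟩
  exact hx

theorem eq_zero_of_sq_notMem_spectrum {W : Type*} [AddCommGroup W] [Module ℂ W]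
    {A : Module.End ℂ W} {c : ℂ} (hc : c ^ 2 ∉ spectrum ℂ (A ^ 2)) {a b : W}
    (ha : A a = (Complex.I * c) • b) (hb : A b = -(Complex.I * c) • a) : a = 0 ∧ b = 0 := by
  have key {w : W} (hw : A (A w) = c ^ 2 • w) : w = 0 := by
    by_contra hne
    exact hc (Module.End.hasEigenvalue_of_hasEigenvector
      (x := w) ⟨Module.End.mem_eigenspace_iff.2 (by rw [pow_two]; exact hw), hne⟩).mem_spectrum
  have hI : -(Complex.I * c * (Complex.I * c)) = c ^ 2 := by
    linear_combination (-c ^ 2) * Complex.I_sq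
  constructor <;> apply key
  · rw [ha, map_smul, hb, smul_smul, mul_neg, hI]
  · rw [hb, map_smul, ha, smul_smul, neg_mul, hI]

section Quantization

variable {s : ℝ} {V : Type} [AddCommGroup V] [Module ℂ V]
  {Q : ↥(Otilde s) →ₗ[ℝ] Module.End ℂ V}

theorem map_pb (hbracket : ∀ f g h : Otilde s, (h : SpherePoly s) = pbS s f g →
      Q h = -Complex.I • (Q f * Q g - Q g * Q f))
    {f g : MvPolynomial (Fin 3) ℝ} (hf : f ∈ oddLift s) (hg : g ∈ oddLift s)
    (hfg : pb f g ∈ oddLift s) :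
    Q ⟨toSphere s (pb f g), hfg⟩ = -Complex.I •
      (Q ⟨toSphere s f, hf⟩ * Q ⟨toSphere s g, hg⟩ -
        Q ⟨toSphere s g, hg⟩ * Q ⟨toSphere s f, hf⟩) :=
  hbracket ⟨_, hf⟩ ⟨_, hg⟩ ⟨_, hfg⟩ (pbS_toSphere s f g).symm

theorem pb_mem_oddKer (hbracket : ∀ f g h : Otilde s, (h : SpherePoly s) = pbS s f g →
      Q h = -Complex.I • (Q f * Q g - Q g * Q f))
    {f g : MvPolynomial (Fin 3) ℝ} (hf : f ∈ oddLift s) (hg : g ∈ oddKer Q)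
    (hfg : pb f g ∈ oddLift s) : pb f g ∈ oddKer Q := by
  have hg' := oddKer_le_oddLift Q hg
  rw [mem_oddKer hfg, map_pb hbracket hf hg' hfg, (mem_oddKer hg').1 hg]
  simp

theorem pbX_mem_oddKer (hbracket : ∀ f g h : Otilde s, (h : SpherePoly s) = pbS s f g →
      Q h = -Complex.I • (Q f * Q g - Q g * Q f))
    (i : Fin 3) {p : MvPolynomial (Fin 3) ℝ} (hp : p ∈ oddKer Q) : pbX i p ∈ oddKer Q :=
  pb_mem_oddKer hbracket (S_mem_Otilde s i) hp (pbX_mem_oddLift s i (oddKer_le_oddLift Q hp))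

theorem zonal_mem_oddKer_of_succ (hs : s ≠ 0)
    (hbracket : ∀ f g h : Otilde s, (h : SpherePoly s) = pbS s f g →
      Q h = -Complex.I • (Q f * Q g - Q g * Q f))
    {m : ℕ} (hm : zonal (m + 1) ∈ oddKer Q) : zonal m ∈ oddKer Q := by
  have hX (i : Fin 3) := pbX_mem_oddKer hbracket i (pbX_mem_oddKer hbracket i hm)
  have hcas := add_mem (add_mem (hX 0) (hX 1)) (hX 2)
  rw [casimir_zonal_succ, Submodule.add_mem_iff_right _ (Submodule.smul_mem _ _ hm),
    Submodule.smul_mem_iff _ (by positivity)] at hcas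
  have hz := zonal_mem_oddLift s m
  have hsmul : (⟨toSphere s ((X 0 ^ 2 + X 1 ^ 2 + X 2 ^ 2) * zonal m),
      sum_sq_mul_mem_oddLift hz⟩ : Otilde s) = s ^ 2 • ⟨toSphere s (zonal m), hz⟩ :=
    Subtype.ext (toSphere_sum_sq_mul s _)
  rw [mem_oddKer (sum_sq_mul_mem_oddLift hz), hsmul, map_smul,
    smul_eq_zero_iff_right (pow_ne_zero 2 hs)] at hcas
  exact (mem_oddKer hz).2 hcas

theorem exists_reImPow_mem_oddKer [FiniteDimensional ℂ V]
    (hbracket : ∀ f g h : Otilde s, (h : SpherePoly s) = pbS s f g →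
      Q h = -Complex.I • (Q f * Q g - Q g * Q f)) :
    ∃ n, (reImPow (n + 1)).1 ∈ oddKer Q ∧ (reImPow (n + 1)).2 ∈ oddKer Q := by
  set T : Module.End ℂ V := Q ⟨toSphere s (X 2), S_mem_Otilde s 2⟩
  set ad : Module.End ℂ (Module.End ℂ V) :=
    LinearMap.mulLeft ℂ T - LinearMap.mulRight ℂ T
  have hinj : Function.Injective fun n : ℕ => ((2 * n + 1 : ℕ) : ℂ) ^ 2 := by
    intro a b hab
    have : (2 * a + 1) ^ 2 = (2 * b + 1) ^ 2 := by
      dsimp only at hab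
      exact_mod_cast hab
    have := Nat.pow_left_injective two_ne_zero this
    lia
  obtain ⟨n, hn⟩ : ∃ n : ℕ, ((2 * n + 1 : ℕ) : ℂ) ^ 2 ∉ spectrum ℂ (ad ^ 2) := by
    by_contra! h
    exact Set.infinite_of_injective_forall_mem hinj h (Module.End.finite_spectrum _)
  have hodd : Odd (2 * n + 1) := odd_two_mul_add_one n
  obtain ⟨hA, hB⟩ := reImPow_mem_harmonicHomog (2 * n + 1)
  replace hA := harmonicHomog_le_oddLift s hodd hA
  replace hB := harmonicHomog_le_oddLift s hodd hB
  obtain ⟨hpA, hpB⟩ := pb_X_two_reImPow (2 * n)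
  have hQA := map_pb hbracket (S_mem_Otilde s 2) hA (pbX_mem_oddLift s 2 hA)
  have hQB := map_pb hbracket (S_mem_Otilde s 2) hB (pbX_mem_oddLift s 2 hB)
  have hsA : (⟨toSphere s (pb (X 2) (reImPow (2 * n + 1)).1), pbX_mem_oddLift s 2 hA⟩ : Otilde s)
      = ((2 * n : ℕ) + 1 : ℝ) • ⟨toSphere s (reImPow (2 * n + 1)).2, hB⟩ :=
    Subtype.ext (congrArg (toSphere s) hpA)
  have hsB : (⟨toSphere s (pb (X 2) (reImPow (2 * n + 1)).2), pbX_mem_oddLift s 2 hB⟩ : Otilde s)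
      = (-((2 * n : ℕ) + 1) : ℝ) • ⟨toSphere s (reImPow (2 * n + 1)).1, hA⟩ :=
    Subtype.ext (congrArg (toSphere s) hpB)
  rw [hsA, map_smul] at hQA
  rw [hsB, map_smul] at hQB
  set a : Module.End ℂ V := Q ⟨toSphere s (reImPow (2 * n + 1)).1, hA⟩
  set b : Module.End ℂ V := Q ⟨toSphere s (reImPow (2 * n + 1)).2, hB⟩
  have hada : ad a = (Complex.I * (2 * n + 1 : ℕ)) • b := by
    have h : ad a = T * a - a * T := rfl
    rw [h, mul_smul, ← Complex.ofReal_natCast, Complex.coe_smul, Nat.cast_add_one, hQA, smul_smul]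
    simp [T]
  have hadb : ad b = -(Complex.I * (2 * n + 1 : ℕ)) • a := by
    have h : ad b = T * b - b * T := rfl
    rw [h, neg_mul_eq_mul_neg, mul_smul, ← Complex.ofReal_natCast, ← Complex.ofReal_neg,
      Complex.coe_smul, Nat.cast_add_one, hQB, smul_smul]
    simp [T]
  obtain ⟨ha, hb⟩ := eq_zero_of_sq_notMem_spectrum hn hada hadb
  exact ⟨2 * n, (mem_oddKer hA).2 ha, (mem_oddKer hB).2 hb⟩

end Quantization

/-- **No-go theorem for the odd polynomials** (Theorem 2.8):
every admissible quantization of `(Õ, P¹)` is trivial. -/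
theorem noGo_odd (s : ℝ) (hs : 0 < s)
    (V : Type) [NormedAddCommGroup V] [InnerProductSpace ℂ V]
    [FiniteDimensional ℂ V] [Nontrivial V]
    (Q : ↥(Otilde s) →ₗ[ℝ] Module.End ℂ V)
    (hselfadj : ∀ f : Otilde s, (Q f).IsSymmetric)
    (hbracket : ∀ f g h : Otilde s, (h : SpherePoly s) = pbS s f g →
      Q h = -Complex.I • (Q f * Q g - Q g * Q f))
    (hone : Q ⟨1, one_mem_Otilde s⟩ = 1)
    (hirred : ∀ W : Submodule ℂ V,
      (∀ i : Fin 3, ∀ v ∈ W, Q ⟨S s i, S_mem_Otilde s i⟩ v ∈ W) → W = ⊥ ∨ W = ⊤) :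
    ∀ i : Fin 3, Q ⟨S s i, S_mem_Otilde s i⟩ = 0 := by
  have hdesc (m : ℕ) (hm : zonal m ∈ oddKer Q) : zonal 0 ∈ oddKer Q := by
    induction m with
    | zero => exact hm
    | succ m ih => exact ih (zonal_mem_oddKer_of_succ hs.ne' hbracket hm)
  obtain ⟨n, hA, hB⟩ := exists_reImPow_mem_oddKer hbracket
  have hz := zonal_mem_oddLift s n
  have hAB : ((n + 1) ^ 2 : ℝ) • zonal n ∈ oddKer Q := by
    rw [← pb_reImPow_succ]
    refine pb_mem_oddKer hbracket (oddKer_le_oddLift Q hA) hB ?_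
    rw [pb_reImPow_succ]
    exact Submodule.smul_mem _ _ hz
  rw [Submodule.smul_mem_iff _ (by positivity)] at hAB
  have h2 : X 2 ∈ oddKer Q := by simpa [zonal] using hdesc n hAB
  have h1 : X 1 ∈ oddKer Q := by
    simpa [pbX, pb, pderiv_X] using pbX_mem_oddKer hbracket 0 h2
  have h0 : X 0 ∈ oddKer Q := by
    simpa [pbX, pb, pderiv_X] using pbX_mem_oddKer hbracket 1 h2
  intro i
  refine (mem_oddKer (S_mem_Otilde s i)).1 ?_
  fin_cases i
  exacts [h0, h1, h2]

end
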